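/- For every preorder ℙ and every natural number n ≥ 2, the Knaster invariant 𝒦ₙ(ℙ) belongs to spec(ℙ). -/

import Mathlib

universe u

/-- Two elements of a preorder are *compatible* if they have a common lower bound. -/
def PCompat {α : Type u} [Preorder α] (p q : α) : Prop := ∃ r, r ≤ p ∧ r ≤ q

/-- An *antichain*: a set of pairwise incompatible elements. -/
def PAntichain {α : Type u} [Preorder α] (A : Set α) : Prop :=
  A.Pairwise fun p q => ¬ PCompat p q

/-- The *cellularity* of a preorder: the supremum of ℵ₀ and the cardinalities of antichains. -/
noncomputable def cellularity (α : Type u) [Preorder α] : Cardinal.{u} :=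
  max Cardinal.aleph0
    (sSup {c : Cardinal.{u} | ∃ A : Set α, PAntichain A ∧ c = Cardinal.mk ↑A})

/-- The *cellular spectrum* of a preorder: the infinite cardinals κ such that the product
with any preorder of cellularity at most κ has cellularity at most κ. -/
def cellSpec (α : Type u) [Preorder α] : Set Cardinal.{u} :=
  {κ | Cardinal.aleph0 ≤ κ ∧
    ∀ (β : Type u) [Preorder β], cellularity β ≤ κ → cellularity (α × β) ≤ κ}

/-- A subset A of a preorder is *n-linked* if every n-element subset of A has a common
lower bound. -/
def NLinked {α : Type u} [Preorder α] (n : ℕ) (A : Set α) : Prop :=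
  ∀ F : Finset α, ↑F ⊆ A → F.card = n → ∃ r : α, ∀ p ∈ F, r ≤ p

/-- The *Knaster invariant* 𝒦ₙ(α): the least infinite cardinal κ such that every subset
of cardinality κ⁺ has an n-linked subset of cardinality κ⁺. -/
noncomputable def knaster (α : Type u) [Preorder α] (n : ℕ) : Cardinal.{u} :=
  sInf {κ : Cardinal.{u} | Cardinal.aleph0 ≤ κ ∧
    ∀ A : Set α, Cardinal.mk ↑A = Order.succ κ →
      ∃ B ⊆ A, NLinked n B ∧ Cardinal.mk ↑B = Order.succ κ}

theorem mk_le_of_cellularity {β : Type u} [Preorder β] {κ : Cardinal.{u}}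
    (h : cellularity β ≤ κ) (A : Set β) (hA : PAntichain A) : Cardinal.mk A ≤ κ := by
  refine le_trans (le_trans ?_ (le_max_right _ _)) h
  refine le_csSup ⟨Cardinal.mk β, ?_⟩ ⟨A, hA, rfl⟩
  rintro c ⟨B, -, rfl⟩
  exact Cardinal.mk_set_le B

theorem mk_le_of_fst_compat {α β : Type u} [Preorder α] [Preorder β] {κ : Cardinal.{u}}
    (h : cellularity β ≤ κ) (A S : Set (α × β)) (hA : PAntichain A) (hS : S ⊆ A)
    (hc : ∀ x ∈ S, ∀ y ∈ S, PCompat x.1 y.1) : Cardinal.mk S ≤ κ := by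
  have key : ∀ x ∈ S, ∀ y ∈ S, x ≠ y → ¬ PCompat x.2 y.2 := by
    rintro x hx y hy hxy ⟨r, h1, h2⟩
    obtain ⟨q, h3, h4⟩ := hc x hx y hy
    exact hA (hS hx) (hS hy) hxy ⟨(q, r), ⟨h3, h1⟩, ⟨h4, h2⟩⟩
  have inj : Set.InjOn Prod.snd S := by
    intro x hx y hy hxy
    by_contra hne
    exact key x hx y hy hne ⟨x.2, le_rfl, hxy.le⟩
  rw [← Cardinal.mk_image_eq_of_injOn _ _ inj]
  apply mk_le_of_cellularity h
  rintro _ ⟨x, hx, rfl⟩ _ ⟨y, hy, rfl⟩ hne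
  exact key x hx y hy (fun e => hne (by rw [e]))

theorem knaster_spec (α : Type u) [Preorder α] (n : ℕ) :
    Cardinal.aleph0 ≤ knaster α n ∧
    ∀ A : Set α, Cardinal.mk ↑A = Order.succ (knaster α n) →
      ∃ B ⊆ A, NLinked n B ∧ Cardinal.mk ↑B = Order.succ (knaster α n) := by
  refine csInf_mem (s := {κ : Cardinal.{u} | Cardinal.aleph0 ≤ κ ∧
    ∀ A : Set α, Cardinal.mk ↑A = Order.succ κ →
      ∃ B ⊆ A, NLinked n B ∧ Cardinal.mk ↑B = Order.succ κ})
    ⟨max Cardinal.aleph0 (Cardinal.mk α), le_max_left _ _, ?_⟩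
  intro A hA
  have h1 := Cardinal.mk_set_le A
  rw [hA, Order.succ_le_iff] at h1
  exact absurd (le_max_right _ _) (not_le.2 h1)

theorem NLinked.compat {α : Type u} [Preorder α] {n : ℕ} (hn : 2 ≤ n) {B : Set α}
    (hB : NLinked n B) (hinf : B.Infinite) {p q : α} (hp : p ∈ B) (hq : q ∈ B) :
    PCompat p q := by
  classical
  obtain ⟨F, h1, h2, h3⟩ := hinf.exists_superset_ncard_eq (s := {p, q}) (t := B) (k := n)
    (by rintro x (rfl | rfl) <;> assumption) (by simp)
    ((Set.ncard_insert_le _ _).trans (by simpa using hn))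
  have hfin : F.Finite := Set.finite_of_ncard_pos (by omega)
  obtain ⟨r, hr⟩ := hB hfin.toFinset (by simpa using h2)
    (by rw [← Set.ncard_eq_toFinset_card F hfin, h3])
  exact ⟨r, hr p (by simpa using h1 (by simp)), hr q (by simpa using h1 (by simp))⟩

/-- For every n ≥ 2, the Knaster invariant 𝒦ₙ(ℙ) belongs to spec(ℙ). -/
theorem knaster_mem_cellSpec {α : Type u} [Preorder α] (n : ℕ) (hn : 2 ≤ n) :
    knaster α n ∈ cellSpec α := by
  obtain ⟨h0, hk⟩ := knaster_spec α n
  refine ⟨h0, ?_⟩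
  intro β _ hβ
  generalize knaster α n = κ at *
  refine max_le h0 (csSup_le' ?_)
  rintro _ ⟨A, hA, rfl⟩
  have hfib : ∀ b : ↑(Prod.fst '' A),
      Cardinal.mk ((fun x : A => (⟨x.1.1, x.1, x.2, rfl⟩ : ↑(Prod.fst '' A))) ⁻¹' {b}) ≤ κ := by
    intro b
    rw [← Cardinal.mk_image_eq (f := (Subtype.val : A → α × β)) Subtype.val_injective]
    apply mk_le_of_fst_compat hβ A _ hA
    · rintro _ ⟨x, -, rfl⟩
      exact x.2
    · rintro _ ⟨x, hx, rfl⟩ _ ⟨y, hy, rfl⟩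
      have e : x.1.1 = y.1.1 := congrArg Subtype.val (hx.trans hy.symm)
      exact ⟨x.1.1, le_rfl, e.le⟩
  have himg : Cardinal.mk ↑(Prod.fst '' A) ≤ κ := by
    by_contra hlt
    rw [not_le, ← Order.succ_le_iff, Cardinal.le_mk_iff_exists_subset] at hlt
    obtain ⟨C, hC, hCc⟩ := hlt
    obtain ⟨B, hBC, hB, hBc⟩ := hk C hCc
    have hinf : B.Infinite := by
      rw [← Set.infinite_coe_iff, Cardinal.infinite_iff, hBc]
      exact h0.trans (Order.le_succ κ)
    have hch : ∀ b : B, ∃ x ∈ A, x.1 = b.1 := fun b => hC (hBC b.2)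
    choose f hf hfe using hch
    have hinj : Function.Injective f := fun a b hab =>
      Subtype.ext (by rw [← hfe a, ← hfe b, hab])
    have := mk_le_of_fst_compat hβ A (Set.range f) hA
      (by rintro _ ⟨b, rfl⟩; exact hf b)
      (by
        rintro _ ⟨a, rfl⟩ _ ⟨b, rfl⟩
        rw [hfe, hfe]
        exact hB.compat hn hinf a.2 b.2)
    rw [Cardinal.mk_range_eq f hinj, hBc] at this
    exact absurd this (not_le.2 (Order.lt_succ κ))
  exact (Cardinal.mk_le_mk_mul_of_mk_preimage_le _ hfib).trans
    ((mul_le_mul' himg le_rfl).trans (Cardinal.mul_eq_self h0).le)
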